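/- Let 𝒜 be a C*-algebra, 𝔦 a stable Calkin space, and a₁,…,aₘ, b₁,…,bₘ ∈ 𝒜; let Φ = Σ_{i=1}^m M_{a_i,b_i} : 𝒜 → 𝒜. Suppose π : 𝒜 → B(H) is a faithful *-representation such that each π(a_i) and π(b_i) is a compact operator with s(π(a_i)) ∈ 𝔦 and s(π(b_i)) ∈ 𝔦 for i = 1,…,m. Then the sequence (aₙ(Φ))_{n≥1} of approximation numbers of Φ belongs to 𝔦 (hence s(Φ) ∈ 𝔦 for every s-number function s, since sₙ(Φ) ≤ aₙ(Φ)). -/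

import Mathlib

open scoped BigOperators

noncomputable section

/-- The space of complex null sequences `c₀`. -/
def c0 : Set (ℕ → ℂ) := {α | Filter.Tendsto α Filter.atTop (nhds 0)}

/-- `rearrSum α n` is the supremum of `∑_{i ∈ F} |α i|` over finite sets `F ⊆ ℕ` with
`|F| = n`; for a null sequence it equals `α*₁ + ⋯ + α*ₙ` where `α*` is the decreasing
rearrangement of `(|α_n|)`. -/
def rearrSum (α : ℕ → ℂ) (n : ℕ) : ℝ :=
  sSup ((fun F : Finset ℕ => ∑ i ∈ F, ‖α i‖) '' {F | F.card = n})

/-- The decreasing rearrangement of a null sequence, 0-indexed: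
`rearr α n = α*_{n+1}`. -/
def rearr (α : ℕ → ℂ) (n : ℕ) : ℝ := rearrSum α (n + 1) - rearrSum α n

/-- A Calkin space: a linear subspace of `c₀` containing every null sequence whose
decreasing rearrangement is dominated termwise by that of one of its members. -/
def IsCalkinSpace (I : Set (ℕ → ℂ)) : Prop :=
  I ⊆ c0 ∧ (0 : ℕ → ℂ) ∈ I ∧
  (∀ α ∈ I, ∀ β ∈ I, α + β ∈ I) ∧
  (∀ (c : ℂ), ∀ α ∈ I, c • α ∈ I) ∧
  (∀ α ∈ I, ∀ β ∈ c0, (∀ n, rearr β n ≤ rearr α n) → β ∈ I)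

/-- `tensorSum α β n` is the supremum of `∑_{(i,j) ∈ F} |α i| |β j|` over finite
`F ⊆ ℕ × ℕ` with `|F| = n`; it equals `(α⊗β)₁ + ⋯ + (α⊗β)ₙ`. -/
def tensorSum (α β : ℕ → ℂ) (n : ℕ) : ℝ :=
  sSup ((fun F : Finset (ℕ × ℕ) => ∑ p ∈ F, ‖α p.1‖ * ‖β p.2‖) '' {F | F.card = n})

/-- The tensor sequence `α⊗β`: the decreasing rearrangement of the double sequence
`(|α_m β_n|)_{m,n}`, 0-indexed: `tensorSeq α β n = (α⊗β)_{n+1}`. -/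
def tensorSeq (α β : ℕ → ℂ) (n : ℕ) : ℝ := tensorSum α β (n + 1) - tensorSum α β n

/-- Embedding of real sequences into complex sequences. -/
def toC (f : ℕ → ℝ) : ℕ → ℂ := fun n => (f n : ℂ)

/-- The tensor product `𝔦⊗𝔧` of two Calkin spaces: the smallest Calkin space
containing `α⊗β` for all `α ∈ 𝔦`, `β ∈ 𝔧`. -/
def calkinTensor (I J : Set (ℕ → ℂ)) : Set (ℕ → ℂ) :=
  ⋂₀ {K | IsCalkinSpace K ∧ ∀ α ∈ I, ∀ β ∈ J, toC (tensorSeq α β) ∈ K}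

/-- A Calkin space `𝔦` is stable if `𝔦⊗𝔦 = 𝔦`. -/
def IsStableCalkin (I : Set (ℕ → ℂ)) : Prop := IsCalkinSpace I ∧ calkinTensor I I = I

/-- The principal Calkin space `⟨α⟩` generated by `α`: the smallest Calkin space
containing `α`. -/
def principalCalkin (α : ℕ → ℂ) : Set (ℕ → ℂ) := ⋂₀ {K | IsCalkinSpace K ∧ α ∈ K}

/-- `Kw ω α n = #{m : ω^{n+1} < α m ≤ ω^n}` (the sequence `α` being 0-indexed). -/
def Kw (ω : ℝ) (α : ℕ → ℝ) (n : ℕ) : ℕ :=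
  Set.ncard {m : ℕ | ω ^ (n + 1) < α m ∧ α m ≤ ω ^ n}

/-- `K̃ₙ = Σ_{i=0}^n Kᵢ`. -/
def Ktil (ω : ℝ) (α : ℕ → ℝ) (n : ℕ) : ℕ := ∑ i ∈ Finset.range (n + 1), Kw ω α i

/-- `Mₙ = Σ_{i+j=n} Kᵢ Kⱼ`. -/
def Mw (ω : ℝ) (α : ℕ → ℝ) (n : ℕ) : ℕ :=
  ∑ i ∈ Finset.range (n + 1), Kw ω α i * Kw ω α (n - i)

/-- `M̃ₙ = Σ_{i=0}^n Mᵢ`. -/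
def Mtil (ω : ℝ) (α : ℕ → ℝ) (n : ℕ) : ℕ := ∑ i ∈ Finset.range (n + 1), Mw ω α i

/-- The `n`-th approximation number of `T` (1-indexed: `approxNum T n = aₙ(T)` is the
infimum of `‖T - F‖` over bounded operators `F` of rank `< n`).  For operators between
Hilbert spaces this equals the `n`-th singular number. -/
def approxNum {X Y : Type*} [NormedAddCommGroup X] [NormedSpace ℂ X]
    [NormedAddCommGroup Y] [NormedSpace ℂ Y] (T : X →L[ℂ] Y) (n : ℕ) : ℝ :=
  sInf {c | ∃ F : X →L[ℂ] Y, LinearMap.rank (F : X →ₗ[ℂ] Y) < (n : Cardinal) ∧ c = ‖T - F‖}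

/-- The `n`-th Kolmogorov number `dₙ(T)` (1-indexed). -/
def kolNum {X Y : Type*} [NormedAddCommGroup X] [NormedSpace ℂ X]
    [NormedAddCommGroup Y] [NormedSpace ℂ Y] (T : X →L[ℂ] Y) (n : ℕ) : ℝ :=
  sInf {c | ∃ V : Submodule ℂ Y, Module.rank ℂ V < (n : Cardinal) ∧
    c = ⨆ x : {x : X // ‖x‖ ≤ 1}, ⨅ y : V, ‖T x.1 - (y : Y)‖}

/-- The `n`-th Hilbert number `hₙ(T)` (1-indexed): the supremum of `sₙ(A ∘ T ∘ B)` over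
all Hilbert spaces `K`, `H'` and all contractions `B : K → X`, `A : Y → H'`. -/
def hilbertNum {X Y : Type u} [NormedAddCommGroup X] [NormedSpace ℂ X]
    [NormedAddCommGroup Y] [NormedSpace ℂ Y] (T : X →L[ℂ] Y) (n : ℕ) : ℝ :=
  sSup {c | ∃ (K : Type u) (_ : NormedAddCommGroup K) (_ : InnerProductSpace ℂ K)
    (_ : CompleteSpace K) (H' : Type u) (_ : NormedAddCommGroup H')
    (_ : InnerProductSpace ℂ H') (_ : CompleteSpace H')
    (B : K →L[ℂ] X) (A : Y →L[ℂ] H'), ‖B‖ ≤ 1 ∧ ‖A‖ ≤ 1 ∧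
    c = approxNum ((A.comp T).comp B) n}

/-- The sequence of singular numbers of an operator, 0-indexed:
`sSeq T n = s_{n+1}(T) = a_{n+1}(T)`. -/
def sSeq {X Y : Type*} [NormedAddCommGroup X] [NormedSpace ℂ X]
    [NormedAddCommGroup Y] [NormedSpace ℂ Y] (T : X →L[ℂ] Y) : ℕ → ℝ :=
  fun n => approxNum T (n + 1)

/-- The multiplication operator `M_{a,b} : x ↦ a * x * b` on a normed algebra. -/
def Mop {A : Type*} [NonUnitalNormedRing A] [NormedSpace ℂ A] [IsScalarTower ℂ A A]
    [SMulCommClass ℂ A A] (a b : A) : A →L[ℂ] A :=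
  (ContinuousLinearMap.mul ℂ A a).comp ((ContinuousLinearMap.mul ℂ A).flip b)

/-! ### Sequences -/

lemma c0_bounded {α : ℕ → ℂ} (h : α ∈ c0) : ∃ C : ℝ, ∀ n, ‖α n‖ ≤ C := by
  have h' : Filter.Tendsto α Filter.atTop (nhds 0) := h
  obtain ⟨C, hC⟩ := (Metric.isBounded_range_of_tendsto α h').exists_norm_le
  exact ⟨C, fun n => hC _ ⟨n, rfl⟩⟩

/-- The supremum of sums of `w` over finite sets of given cardinality. -/
def supSum {ι : Type*} (w : ι → ℝ) (n : ℕ) : ℝ :=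
  sSup ((fun F : Finset ι => ∑ i ∈ F, w i) '' {F | F.card = n})

lemma supSum_bdd {ι : Type*} {w : ι → ℝ} {C : ℝ} (hw : ∀ i, w i ≤ C) (n : ℕ) :
    BddAbove ((fun F : Finset ι => ∑ i ∈ F, w i) '' {F | F.card = n}) := by
  refine ⟨n * C, ?_⟩
  rintro _ ⟨F, hF, rfl⟩
  have := Finset.sum_le_card_nsmul F w C (fun i _ => hw i)
  rw [Set.mem_ofPred_eq] at hF
  simpa [hF] using this

lemma le_supSum {ι : Type*} {w : ι → ℝ} {C : ℝ} (hw : ∀ i, w i ≤ C) (F : Finset ι) :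
    ∑ i ∈ F, w i ≤ supSum w F.card :=
  le_csSup (supSum_bdd hw _) ⟨F, rfl, rfl⟩

lemma supSum_le {ι : Type*} [Infinite ι] {w : ι → ℝ} {n : ℕ} {c : ℝ}
    (h : ∀ F : Finset ι, F.card = n → ∑ i ∈ F, w i ≤ c) : supSum w n ≤ c := by
  refine csSup_le ?_ ?_
  · obtain ⟨F, hF⟩ := Infinite.exists_subset_card_eq ι n
    exact ⟨_, F, hF, rfl⟩
  · rintro _ ⟨F, hF, rfl⟩
    exact h F hF

lemma supSum_lower {ι : Type*} [Infinite ι] [DecidableEq ι] {w : ι → ℝ} {C : ℝ}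
    (hw : ∀ i, w i ≤ C)
    {n : ℕ} {s : ℝ} (G : Finset ι) (hG : n < G.card) (hs : ∀ i ∈ G, s ≤ w i) :
    s ≤ supSum w (n + 1) - supSum w n := by
  have : supSum w n ≤ supSum w (n + 1) - s := by
    apply supSum_le
    intro F hF
    obtain ⟨i, hi, hiF⟩ := Finset.exists_mem_notMem_of_card_lt_card (s := F) (t := G) (by omega)
    have h1 := le_supSum hw (insert i F)
    rw [Finset.card_insert_of_notMem hiF, Finset.sum_insert hiF, hF] at h1
    linarith [hs i hi]
  linarith

lemma supSum_upper {ι : Type*} [Infinite ι] [DecidableEq ι] {w : ι → ℝ} {C : ℝ}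
    (hw : ∀ i, w i ≤ C)
    {n : ℕ} {s : ℝ} (G : Finset ι) (hG : G.card ≤ n) (hs : ∀ i ∉ G, w i ≤ s) :
    supSum w (n + 1) - supSum w n ≤ s := by
  have : supSum w (n + 1) ≤ supSum w n + s := by
    apply supSum_le
    intro F hF
    obtain ⟨i, hi, hiF⟩ := Finset.exists_mem_notMem_of_card_lt_card (s := G) (t := F) (by omega)
    have h1 := le_supSum hw (F.erase i)
    rw [Finset.card_erase_of_mem hi, hF] at h1
    simp only [Nat.add_sub_cancel] at h1
    rw [← Finset.add_sum_erase F w hi]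
    linarith [hs i hiF]
  linarith

lemma rearr_lower {α : ℕ → ℂ} (h : α ∈ c0) {n : ℕ} {s : ℝ} (G : Finset ℕ) (hG : n < G.card)
    (hs : ∀ i ∈ G, s ≤ ‖α i‖) : s ≤ rearr α n := by
  obtain ⟨C, hC⟩ := c0_bounded h
  exact supSum_lower hC G hG hs

lemma rearr_upper {α : ℕ → ℂ} (h : α ∈ c0) {n : ℕ} {s : ℝ} (G : Finset ℕ) (hG : G.card ≤ n)
    (hs : ∀ i ∉ G, ‖α i‖ ≤ s) : rearr α n ≤ s := by
  obtain ⟨C, hC⟩ := c0_bounded h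
  exact supSum_upper hC G hG hs

lemma tensorSeq_lower {α β : ℕ → ℂ} (hα : α ∈ c0) (hβ : β ∈ c0) {n : ℕ} {s : ℝ}
    (G : Finset (ℕ × ℕ)) (hG : n < G.card)
    (hs : ∀ p ∈ G, s ≤ ‖α p.1‖ * ‖β p.2‖) : s ≤ tensorSeq α β n := by
  obtain ⟨C, hC⟩ := c0_bounded hα
  obtain ⟨D, hD⟩ := c0_bounded hβ
  have hb : ∀ p : ℕ × ℕ, ‖α p.1‖ * ‖β p.2‖ ≤ C * D := fun p =>
    mul_le_mul (hC _) (hD _) (norm_nonneg _) ((norm_nonneg _).trans (hC 0))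
  exact supSum_lower (w := fun p : ℕ × ℕ => ‖α p.1‖ * ‖β p.2‖) hb G hG hs

lemma tensorSeq_nonneg {α β : ℕ → ℂ} (hα : α ∈ c0) (hβ : β ∈ c0) (n : ℕ) :
    0 ≤ tensorSeq α β n := by
  obtain ⟨G, hG⟩ := Infinite.exists_subset_card_eq (ℕ × ℕ) (n + 1)
  exact tensorSeq_lower hα hβ G (by omega) (fun p _ => by positivity)

lemma norm_toC {f : ℕ → ℝ} (h : ∀ n, 0 ≤ f n) (n : ℕ) : ‖toC f n‖ = f n := by
  simp [toC, abs_of_nonneg (h n)]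

/-- An antitone nonnegative sequence dominated by a member of a Calkin space is in it. -/
lemma mem_of_le {I : Set (ℕ → ℂ)} (hI : IsCalkinSpace I) {f : ℕ → ℝ} (hf : Antitone f)
    (hf0 : ∀ n, 0 ≤ f n) {g : ℕ → ℂ} (hg : g ∈ I) (hfg : ∀ n, f n ≤ ‖g n‖) : toC f ∈ I := by
  obtain ⟨h1, -, -, -, h5⟩ := hI
  have hgc : Filter.Tendsto g Filter.atTop (nhds 0) := h1 hg
  have hfc : toC f ∈ c0 := by
    refine squeeze_zero_norm (a := fun n => ‖g n‖) (fun n => ?_) (by simpa using hgc.norm)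
    rw [norm_toC hf0]; exact hfg n
  refine h5 g hg _ hfc (fun n => ?_)
  refine (rearr_upper hfc (Finset.range n) (by simp) (s := f n) ?_).trans
    (rearr_lower (h1 hg) (Finset.range (n + 1)) (by simp) ?_)
  · intro i hi
    rw [norm_toC hf0]
    exact hf (by simpa using hi)
  · intro i hi
    exact (hf (by simp at hi; omega)).trans (hfg i)

/-- A Calkin space is closed under the two-fold dilation of antitone sequences. -/
lemma dilate_mem {I : Set (ℕ → ℂ)} (hI : IsCalkinSpace I) {f : ℕ → ℝ} (hf : Antitone f)
    (hf0 : ∀ n, 0 ≤ f n) (hfI : toC f ∈ I) : toC (fun n => f (n / 2)) ∈ I := by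
  have hI' := hI
  obtain ⟨h1, -, h3, -, h5⟩ := hI'
  have hfc : Filter.Tendsto (toC f) Filter.atTop (nhds 0) := h1 hfI
  have hlim : Filter.Tendsto (fun n => ‖toC f (n / 2)‖) Filter.atTop (nhds 0) := by
    have := hfc.norm.comp (Nat.tendsto_div_const_atTop (n := 2) (by norm_num))
    simpa [Function.comp_def] using this
  have key : ∀ j < 2, toC (fun n => if n % 2 = j then f (n / 2) else 0) ∈ I := by
    intro j hj
    have hnn : ∀ n, 0 ≤ (if n % 2 = j then f (n / 2) else 0) := by
      intro n; split_ifs; exacts [hf0 _, le_rfl]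
    have hc : toC (fun n => if n % 2 = j then f (n / 2) else 0) ∈ c0 := by
      refine squeeze_zero_norm (fun n => ?_) hlim
      rw [norm_toC hnn, norm_toC hf0]
      split_ifs; exacts [le_rfl, hf0 _]
    refine h5 _ hfI _ hc (fun n => ?_)
    refine (rearr_upper hc ((Finset.range n).image (fun i => 2 * i + j))
      (Finset.card_image_le.trans (by simp)) (s := f n) ?_).trans
      (rearr_lower (h1 hfI) (Finset.range (n + 1)) (by simp) ?_)
    · intro i hi
      rw [norm_toC hnn]
      split_ifs with h
      · apply hf
        by_contra hlt
        apply hi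
        rw [Finset.mem_image]
        exact ⟨i / 2, by simp; omega, by omega⟩
      · exact hf0 n
    · intro i hi
      rw [norm_toC hf0]
      exact hf (by simp at hi; omega)
  have := h3 _ (key 0 (by norm_num)) _ (key 1 (by norm_num))
  convert this using 1
  funext n
  rcases Nat.mod_two_eq_zero_or_one n with h | h <;> simp [toC, h]

/-! ### Approximation numbers -/

section approx

variable {X Y : Type*} [NormedAddCommGroup X] [NormedSpace ℂ X]
    [NormedAddCommGroup Y] [NormedSpace ℂ Y]

lemma approxNum_bddBelow (T : X →L[ℂ] Y) (n : ℕ) :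
    BddBelow {c | ∃ F : X →L[ℂ] Y, LinearMap.rank (F : X →ₗ[ℂ] Y) < (n : Cardinal) ∧
      c = ‖T - F‖} := by
  refine ⟨0, ?_⟩
  rintro _ ⟨F, -, rfl⟩
  exact norm_nonneg _

lemma approxNum_le {T F : X →L[ℂ] Y} {n : ℕ}
    (h : LinearMap.rank (F : X →ₗ[ℂ] Y) ≤ (n : Cardinal)) : approxNum T (n + 1) ≤ ‖T - F‖ := by
  refine csInf_le (approxNum_bddBelow T _) ⟨F, ?_, rfl⟩
  refine h.trans_lt ?_
  exact_mod_cast Nat.lt_succ_self n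

lemma approxNum_nonempty (T : X →L[ℂ] Y) (n : ℕ) :
    Set.Nonempty {c | ∃ F : X →L[ℂ] Y,
      LinearMap.rank (F : X →ₗ[ℂ] Y) < ((n + 1 : ℕ) : Cardinal) ∧ c = ‖T - F‖} := by
  refine ⟨_, 0, ?_, rfl⟩
  simp only [ContinuousLinearMap.toLinearMap_zero, LinearMap.rank_zero]
  exact_mod_cast Nat.succ_pos n

lemma approxNum_nonneg (T : X →L[ℂ] Y) (n : ℕ) : 0 ≤ approxNum T n := by
  apply Real.sInf_nonneg
  rintro _ ⟨F, -, rfl⟩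
  exact norm_nonneg _

lemma rank_lt_succ {F : X →ₗ[ℂ] Y} {n : ℕ}
    (h : LinearMap.rank F < ((n + 1 : ℕ) : Cardinal)) : LinearMap.rank F ≤ (n : Cardinal) := by
  rw [Nat.cast_add_one] at h
  exact Cardinal.lt_natCast_add_one_iff.1 h

lemma le_approxNum {T : X →L[ℂ] Y} {n : ℕ} {c : ℝ}
    (h : ∀ F : X →L[ℂ] Y, LinearMap.rank (F : X →ₗ[ℂ] Y) ≤ (n : Cardinal) → c ≤ ‖T - F‖) :
    c ≤ approxNum T (n + 1) := by
  refine le_csInf (approxNum_nonempty T n) ?_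
  rintro _ ⟨F, hF, rfl⟩
  exact h F (rank_lt_succ hF)

lemma sSeq_antitone (T : X →L[ℂ] Y) : Antitone (sSeq T) := by
  intro m n hmn
  refine le_approxNum fun F hF => approxNum_le (hF.trans ?_)
  exact_mod_cast hmn

lemma approxNum_add (S T : X →L[ℂ] Y) (n : ℕ) :
    approxNum (S + T) (2 * n + 1) ≤ approxNum S (n + 1) + approxNum T (n + 1) := by
  rw [← sub_le_iff_le_add]
  refine le_approxNum fun F hF => ?_
  rw [sub_le_comm]
  refine le_approxNum fun G hG => ?_
  have h : LinearMap.rank ((F + G : X →L[ℂ] Y) : X →ₗ[ℂ] Y) ≤ ((2 * n : ℕ) : Cardinal) := by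
    rw [ContinuousLinearMap.toLinearMap_add]
    refine (LinearMap.rank_add_le _ _).trans ((add_le_add hF hG).trans ?_)
    rw [two_mul]; push_cast; exact le_rfl
  have h2 := approxNum_le (T := S + T) h
  have h3 : ‖S + T - (F + G)‖ ≤ ‖S - F‖ + ‖T - G‖ := by
    rw [add_sub_add_comm]; exact norm_add_le _ _
  linarith

lemma sSeq_add_mem {I : Set (ℕ → ℂ)} (hI : IsCalkinSpace I) {S T : X →L[ℂ] Y}
    (hS : toC (sSeq S) ∈ I) (hT : toC (sSeq T) ∈ I) : toC (sSeq (S + T)) ∈ I := by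
  have h0 : ∀ (R : X →L[ℂ] Y) n, 0 ≤ sSeq R n := fun R n => approxNum_nonneg R _
  have h1 : toC (fun n => sSeq S n + sSeq T n) ∈ I := by
    have := hI.2.2.1 _ hS _ hT
    convert this using 1
    funext n; simp [toC]
  have h2 := dilate_mem hI (fun m n hmn => add_le_add (sSeq_antitone S hmn) (sSeq_antitone T hmn))
    (fun n => add_nonneg (h0 S n) (h0 T n)) h1
  refine mem_of_le hI (sSeq_antitone _) (h0 _) h2 (fun n => ?_)
  rw [norm_toC (fun n => add_nonneg (h0 S _) (h0 T _))]
  exact (sSeq_antitone (S + T) (Nat.mul_div_le n 2)).trans (approxNum_add S T (n / 2))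

lemma sSeq_sum_mem {I : Set (ℕ → ℂ)} (hI : IsCalkinSpace I) {ι : Type*} (s : Finset ι)
    (T : ι → X →L[ℂ] Y) (h : ∀ i, toC (sSeq (T i)) ∈ I) : toC (sSeq (∑ i ∈ s, T i)) ∈ I := by
  classical
  induction s using Finset.induction_on with
  | empty =>
    refine mem_of_le hI (sSeq_antitone _) (fun n => approxNum_nonneg _ _) hI.2.1 (fun n => ?_)
    have := approxNum_le (T := (0 : X →L[ℂ] Y)) (F := 0) (n := n) (by simp)
    simpa [sSeq] using this
  | insert i s hi ih =>
    rw [Finset.sum_insert hi]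
    exact sSeq_add_mem hI (h i) ih

end approx

/-- If `T` is bounded below by `s` on the range of `X` then the rank of `X` is controlled by the
approximation numbers of `T`. -/
lemma rank_le_of_bddBelow {H : Type*} [NormedAddCommGroup H] [NormedSpace ℂ H]
    (T X : H →L[ℂ] H) {s : ℝ} {n : ℕ} (hX : ∀ v, s * ‖X v‖ ≤ ‖T (X v)‖)
    (hn : approxNum T (n + 1) < s) : LinearMap.rank (X : H →ₗ[ℂ] H) ≤ (n : Cardinal) := by
  by_contra hcon
  rw [not_le] at hcon
  apply hn.not_ge
  refine le_approxNum fun F hF => ?_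
  -- the restriction of `F` to the range of `X` has a kernel
  let R := LinearMap.range (X : H →ₗ[ℂ] H)
  let G : R →ₗ[ℂ] H := (F : H →ₗ[ℂ] H).domRestrict R
  have hG : ¬ Function.Injective G := by
    intro hinj
    have h1 : Module.rank ℂ R ≤ Module.rank ℂ (LinearMap.range (F : H →ₗ[ℂ] H)) := by
      refine LinearMap.rank_le_of_injective
        (G.codRestrict (LinearMap.range (F : H →ₗ[ℂ] H)) (fun x => ⟨x.1, rfl⟩)) ?_
      intro x y hxy
      exact hinj (congrArg Subtype.val hxy)
    exact (hcon.trans_le (h1.trans hF)).false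
  rw [← LinearMap.ker_eq_bot, Submodule.eq_bot_iff] at hG
  push Not at hG
  obtain ⟨⟨_, v, rfl⟩, hv, hne⟩ := hG
  have hne' : X v ≠ 0 := fun h => hne (Subtype.ext h)
  have hFv : F (X v) = 0 := hv
  have h2 : ‖T (X v)‖ ≤ ‖T - F‖ * ‖X v‖ := by
    have := (T - F).le_opNorm (X v)
    simpa [hFv] using this
  exact le_of_mul_le_mul_right ((hX v).trans h2) (norm_pos_iff.2 hne')

/-- Rank of a two-sided multiplication. -/
lemma rank_Mop_le {𝒜 : Type*} [NonUnitalNormedRing 𝒜] [NormedSpace ℂ 𝒜] [IsScalarTower ℂ 𝒜 𝒜]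
    [SMulCommClass ℂ 𝒜 𝒜] {H : Type*} [NormedAddCommGroup H] [NormedSpace ℂ H]
    (π : 𝒜 →ₙₐ[ℂ] (H →L[ℂ] H)) (hπ : Function.Injective π) (u v : 𝒜) {k l : ℕ}
    (hu : LinearMap.rank (π u : H →ₗ[ℂ] H) ≤ (k : Cardinal))
    (hv : LinearMap.rank (π v : H →ₗ[ℂ] H) ≤ (l : Cardinal)) :
    LinearMap.rank (Mop u v : 𝒜 →ₗ[ℂ] 𝒜) ≤ ((k * l : ℕ) : Cardinal) := by
  let U : H →ₗ[ℂ] H := π u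
  let V : H →ₗ[ℂ] H := π v
  have fU : FiniteDimensional ℂ (LinearMap.range U) :=
    Module.rank_lt_aleph0_iff.1 (lt_of_le_of_lt hu (Cardinal.natCast_lt_aleph0))
  have fV : FiniteDimensional ℂ (LinearMap.range V) :=
    Module.rank_lt_aleph0_iff.1 (lt_of_le_of_lt hv (Cardinal.natCast_lt_aleph0))
  have dU : Module.finrank ℂ (LinearMap.range U) ≤ k := Module.finrank_le_of_rank_le hu
  have dV : Module.finrank ℂ (LinearMap.range V) ≤ l := Module.finrank_le_of_rank_le hv
  -- the map from the range of `Mop u v`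
  let P : 𝒜 →ₗ[ℂ] (H →ₗ[ℂ] H) := (ContinuousLinearMap.coeLM ℂ).comp (π : 𝒜 →ₗ[ℂ] (H →L[ℂ] H))
  have hP : Function.Injective P := fun x y h => hπ (ContinuousLinearMap.coe_injective h)
  let Ψ : (LinearMap.range V →ₗ[ℂ] LinearMap.range U) →ₗ[ℂ] (H →ₗ[ℂ] H) :=
    (LinearMap.lcomp ℂ H V.rangeRestrict).comp
      (LinearMap.llcomp ℂ (LinearMap.range V) (LinearMap.range U) H (LinearMap.range U).subtype)
  have hmem : ∀ y : LinearMap.range (Mop u v : 𝒜 →ₗ[ℂ] 𝒜), P y.1 ∈ LinearMap.range Ψ := by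
    rintro ⟨_, x, rfl⟩
    refine ⟨(U.rangeRestrict.comp (P x)).comp (LinearMap.range V).subtype, ?_⟩
    ext w
    simp [Ψ, P, U, V, Mop]
  let Q : LinearMap.range (Mop u v : 𝒜 →ₗ[ℂ] 𝒜) →ₗ[ℂ] LinearMap.range Ψ :=
    (P.domRestrict _).codRestrict _ hmem
  have hQ : Function.Injective Q := fun x y h => Subtype.ext (hP (congrArg Subtype.val h))
  have fQ : FiniteDimensional ℂ (LinearMap.range (Mop u v : 𝒜 →ₗ[ℂ] 𝒜)) :=
    FiniteDimensional.of_injective Q hQ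
  have h1 := LinearMap.finrank_le_finrank_of_injective hQ
  have h2 := LinearMap.finrank_range_le Ψ
  rw [Module.finrank_linearMap] at h2
  have h3 : Module.finrank ℂ (LinearMap.range (Mop u v : 𝒜 →ₗ[ℂ] 𝒜)) ≤ k * l := by
    refine h1.trans (h2.trans ?_)
    rw [mul_comm k l]
    exact Nat.mul_le_mul dV dU
  unfold LinearMap.rank
  rw [← Module.finrank_eq_rank]
  exact_mod_cast h3

/-! ### Spectral blocks in a C*-algebra -/

section blocks

variable {𝒜 : Type*} [NonUnitalCStarAlgebra 𝒜]

lemma quasi_nonneg (a : 𝒜) : ∀ x ∈ quasispectrum ℝ (star a * a), 0 ≤ x := by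
  intro x hx
  rw [Unitization.quasispectrum_eq_spectrum_inr' ℝ ℂ] at hx
  refine spectrum_star_mul_self_nonneg (b := (a : Unitization ℂ 𝒜)) x ?_
  simpa using hx

lemma quasi_le (a : 𝒜) : ∀ x ∈ quasispectrum ℝ (star a * a), x ≤ ‖a‖ ^ 2 := by
  intro x hx
  have h := norm_apply_le_norm_cfcₙ (id : ℝ → ℝ) (star a * a) hx
    continuousOn_id rfl (IsSelfAdjoint.star_mul_self a)
  rw [cfcₙ_id ℝ _ (IsSelfAdjoint.star_mul_self a), CStarRing.norm_star_mul_self, ← sq] at h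
  exact (le_abs_self x).trans h

lemma star_cfcn (f : ℝ → ℝ) (c : 𝒜) : star (cfcₙ f c) = cfcₙ f c :=
  (cfcₙ_predicate f c : IsSelfAdjoint (cfcₙ f c))

/-- `f(c) c g(c)` with `c = a* a`. -/
lemma cfcn_mid (a : 𝒜) {f g : ℝ → ℝ}
    (hf : ContinuousOn f (quasispectrum ℝ (star a * a))) (hf0 : f 0 = 0)
    (hg : ContinuousOn g (quasispectrum ℝ (star a * a))) (hg0 : g 0 = 0) :
    star (a * cfcₙ f (star a * a)) * (a * cfcₙ g (star a * a)) =
      cfcₙ (fun x => f x * (x * g x)) (star a * a) := by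
  have hsa := IsSelfAdjoint.star_mul_self a
  rw [cfcₙ_mul f (fun x => x * g x) (star a * a) hf hf0 (continuousOn_id.mul hg) (by simp),
    cfcₙ_mul (fun x => x) g (star a * a) continuousOn_id rfl hg hg0, cfcₙ_id' ℝ _ hsa,
    star_mul, star_cfcn]
  simp only [mul_assoc]

lemma norm_a_cfcn_le (a : 𝒜) {f : ℝ → ℝ}
    (hf : ContinuousOn f (quasispectrum ℝ (star a * a))) (hf0 : f 0 = 0) {M : ℝ} (hM : 0 ≤ M)
    (h : ∀ x ∈ quasispectrum ℝ (star a * a), 0 ≤ x → f x * (x * f x) ≤ M ^ 2) :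
    ‖a * cfcₙ f (star a * a)‖ ≤ M := by
  refine abs_le_of_sq_le_sq' ?_ hM |>.2
  rw [sq, ← CStarRing.norm_star_mul_self, cfcn_mid a hf hf0 hf hf0]
  refine norm_cfcₙ_le fun x hx => ?_
  have hx0 := quasi_nonneg a x hx
  rw [Real.norm_of_nonneg]
  · exact h x hx hx0
  · nlinarith [mul_nonneg hx0 (mul_self_nonneg (f x))]

lemma norm_a_sub_cfcn_le (a : 𝒜) {f : ℝ → ℝ}
    (hf : ContinuousOn f (quasispectrum ℝ (star a * a))) (hf0 : f 0 = 0) {M : ℝ} (hM : 0 ≤ M)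
    (h : ∀ x ∈ quasispectrum ℝ (star a * a), 0 ≤ x → (1 - f x) * (x * (1 - f x)) ≤ M ^ 2) :
    ‖a - a * cfcₙ f (star a * a)‖ ≤ M := by
  have hsa := IsSelfAdjoint.star_mul_self a
  set c := star a * a with hc
  have hid : ContinuousOn (fun x : ℝ => x) (quasispectrum ℝ c) := continuousOn_id
  refine abs_le_of_sq_le_sq' ?_ hM |>.2
  have key : star (a - a * cfcₙ f c) * (a - a * cfcₙ f c) =
      cfcₙ (fun x => (x - x * f x) - (f x * x - f x * (x * f x))) c := by
    have h1 : cfcₙ (fun x => x * f x) c = c * cfcₙ f c := by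
      rw [cfcₙ_mul (fun x => x) f c hid rfl hf hf0, cfcₙ_id' ℝ _ hsa]
    have h2 : cfcₙ (fun x => f x * x) c = cfcₙ f c * c := by
      rw [cfcₙ_mul f (fun x => x) c hf hf0 hid rfl, cfcₙ_id' ℝ _ hsa]
    have h3 : cfcₙ (fun x => f x * (x * f x)) c = cfcₙ f c * (c * cfcₙ f c) := by
      rw [cfcₙ_mul f (fun x => x * f x) c hf hf0 (hid.mul hf) (by simp), h1]
    rw [cfcₙ_sub (fun x => x - x * f x) (fun x => f x * x - f x * (x * f x)) c
        (hid.sub (hid.mul hf)) (by simp) ((hf.mul hid).sub (hf.mul (hid.mul hf))) (by simp),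
      cfcₙ_sub (fun x => x) (fun x => x * f x) c hid rfl (hid.mul hf) (by simp),
      cfcₙ_sub (fun x => f x * x) (fun x => f x * (x * f x)) c (hf.mul hid) (by simp)
        (hf.mul (hid.mul hf)) (by simp), h1, h2, h3, cfcₙ_id' ℝ _ hsa, star_sub, star_mul,
      star_cfcn, hc]
    simp only [mul_sub, sub_mul, mul_assoc]
    abel
  rw [sq, ← CStarRing.norm_star_mul_self, key]
  refine norm_cfcₙ_le fun x hx => ?_
  have hx0 := quasi_nonneg a x hx
  rw [Real.norm_of_nonneg]
  · have := h x hx hx0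
    linarith
  · nlinarith [mul_nonneg hx0 (mul_self_nonneg (1 - f x))]

variable {H : Type*} [NormedAddCommGroup H] [InnerProductSpace ℂ H] [CompleteSpace H]

lemma norm_sq_rep (π : 𝒜 →⋆ₙₐ[ℂ] (H →L[ℂ] H)) (z : 𝒜) (v : H) :
    (inner ℂ v (π (star z * z) v) : ℂ) = ((‖π z v‖ ^ 2 : ℝ) : ℂ) := by
  rw [map_mul, map_star, ContinuousLinearMap.star_eq_adjoint, mul_apply_eq_comp,
    ContinuousLinearMap.adjoint_inner_right, inner_self_eq_norm_sq_to_K]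
  simp

lemma bddBelow_rep (π : 𝒜 →⋆ₙₐ[ℂ] (H →L[ℂ] H)) (a : 𝒜) {g : ℝ → ℝ}
    (hg : ContinuousOn g (quasispectrum ℝ (star a * a))) {s : ℝ}
    (hgs : ∀ x ≤ s ^ 2, g x = 0) (v : H) :
    s * ‖π (cfcₙ g (star a * a)) v‖ ≤ ‖π a (π (cfcₙ g (star a * a)) v)‖ := by
  have hg0 : g 0 = 0 := hgs 0 (by positivity)
  set c := star a * a with hc
  let q : ℝ → ℝ := fun x => g x * Real.sqrt (max (x - s ^ 2) 0)
  have hq : ContinuousOn q (quasispectrum ℝ c) := by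
    refine hg.mul ?_
    exact Continuous.continuousOn (by fun_prop)
  have hq0 : q 0 = 0 := by simp [q, hg0]
  have key : star (a * cfcₙ g c) * (a * cfcₙ g c) =
      (((s ^ 2 : ℝ) : ℂ)) • (star (cfcₙ g c) * cfcₙ g c) + star (cfcₙ q c) * cfcₙ q c := by
    rw [Complex.coe_smul, hc, cfcn_mid a hg hg0 hg hg0, ← hc, star_cfcn, star_cfcn,
      ← cfcₙ_mul g g c hg hg0 hg hg0, ← cfcₙ_mul q q c hq hq0 hq hq0,
      ← cfcₙ_const_mul (s ^ 2) (fun x => g x * g x) c (hg.mul hg) (by simp [hg0]),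
      ← cfcₙ_add (fun x => s ^ 2 * (g x * g x)) (fun x => q x * q x) c
        (continuousOn_const.mul (hg.mul hg)) (by simp [hg0]) (hq.mul hq) (by simp [hq0])]
    congr 1
    funext x
    rcases le_or_gt x (s ^ 2) with h | h
    · simp [q, hgs x h]
    · have h1 : Real.sqrt (max (x - s ^ 2) 0) * Real.sqrt (max (x - s ^ 2) 0) = x - s ^ 2 := by
        rw [Real.mul_self_sqrt (le_max_right _ _), max_eq_left (by linarith)]
      have : q x * q x = g x * g x * (x - s ^ 2) := by
        rw [← h1]; simp only [q]; ring
      rw [this]; ring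
  have h1 := norm_sq_rep π (a * cfcₙ g c) v
  rw [key, map_add, map_smul, add_apply, inner_add_right,
    smul_apply, inner_smul_right, norm_sq_rep, norm_sq_rep] at h1
  have h2 : s ^ 2 * ‖π (cfcₙ g c) v‖ ^ 2 + ‖π (cfcₙ q c) v‖ ^ 2 = ‖π (a * cfcₙ g c) v‖ ^ 2 := by
    exact_mod_cast h1
  rw [map_mul, mul_apply_eq_comp] at h2
  refine abs_le_of_sq_le_sq' ?_ (norm_nonneg _) |>.2
  rw [mul_pow]
  nlinarith [sq_nonneg ‖π (cfcₙ q c) v‖]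

lemma exists_rank_le (π : 𝒜 →⋆ₙₐ[ℂ] (H →L[ℂ] H)) (a : 𝒜)
    (hα : Filter.Tendsto (sSeq (π a)) Filter.atTop (nhds 0)) {g : ℝ → ℝ}
    (hg : ContinuousOn g (quasispectrum ℝ (star a * a))) {s : ℝ} (hs : 0 < s)
    (hgs : ∀ x ≤ s ^ 2, g x = 0) :
    ∃ n : ℕ, LinearMap.rank (π (cfcₙ g (star a * a)) : H →ₗ[ℂ] H) ≤ (n : Cardinal) := by
  obtain ⟨n, hn⟩ := (hα.eventually (gt_mem_nhds hs)).exists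
  exact ⟨n, rank_le_of_bddBelow (π a) _ (bddBelow_rep π a hg hgs) hn⟩

/-- The spectrum of `a* a` is finite away from zero. -/
lemma finite_spec (π : 𝒜 →⋆ₙₐ[ℂ] (H →L[ℂ] H)) (hπ : Function.Injective π) (a : 𝒜)
    (hα : Filter.Tendsto (sSeq (π a)) Filter.atTop (nhds 0)) {s : ℝ} (hs : 0 < s) :
    (quasispectrum ℝ (star a * a) ∩ Set.Ioi (s ^ 2)).Finite := by
  have hsa := IsSelfAdjoint.star_mul_self a
  set c := star a * a with hc
  let f : ℝ → ℝ := fun x => max (x - s ^ 2) 0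
  have hf : Continuous f := by fun_prop
  have hf0 : f 0 = 0 := by simp [f]; positivity
  obtain ⟨n, hn⟩ := exists_rank_le π a hα (g := f) hf.continuousOn hs
    (fun x hx => by simp [f, hx])
  rw [← hc] at hn
  have hrk := rank_Mop_le (π : 𝒜 →ₙₐ[ℂ] (H →L[ℂ] H)) hπ (cfcₙ f c) (cfcₙ f c) hn hn
  let R := LinearMap.range (Mop (cfcₙ f c) (cfcₙ f c) : 𝒜 →ₗ[ℂ] 𝒜)
  have fR : FiniteDimensional ℂ R :=
    Module.rank_lt_aleph0_iff.1 (lt_of_le_of_lt hrk (Cardinal.natCast_lt_aleph0))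
  have fR' : FiniteDimensional ℝ R := FiniteDimensional.trans ℝ ℂ R
  have hxq : ∀ q : Polynomial ℝ, Continuous (fun x => x * q.eval x) := fun q =>
    continuous_id.mul q.continuous
  let W : Polynomial ℝ →ₗ[ℝ] R :=
    { toFun := fun q => ⟨Mop (cfcₙ f c) (cfcₙ f c) (cfcₙ (fun x => x * q.eval x) c), ⟨_, rfl⟩⟩
      map_add' := by
        intro p q
        apply Subtype.ext
        simp only [Submodule.coe_add]
        rw [← map_add, ← cfcₙ_add _ _ c (hxq p).continuousOn (by simp) (hxq q).continuousOn
          (by simp)]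
        simp only [Polynomial.eval_add, mul_add]
      map_smul' := by
        intro r q
        apply Subtype.ext
        simp only [RingHom.id_apply, Submodule.coe_smul_of_tower]
        have : cfcₙ (fun x => x * (r • q).eval x) c = r • cfcₙ (fun x => x * q.eval x) c := by
          rw [← cfcₙ_const_mul r _ c (hxq q).continuousOn (by simp)]
          congr 1; funext x; simp; ring
        rw [this, ← Complex.coe_smul, map_smul, Complex.coe_smul] }
  have hW : ¬ Function.Injective W := fun h =>
    Polynomial.not_finite (R := ℝ) (Module.Finite.of_injective W h)
  rw [← LinearMap.ker_eq_bot, Submodule.eq_bot_iff] at hW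
  push Not at hW
  obtain ⟨q, hq, hq0⟩ := hW
  have h1 : cfcₙ f c * (cfcₙ (fun x => x * q.eval x) c * cfcₙ f c) = 0 :=
    congrArg Subtype.val hq
  rw [← cfcₙ_mul _ _ c (hxq q).continuousOn (by simp) hf.continuousOn hf0,
    ← cfcₙ_mul f (fun x => x * q.eval x * f x) c hf.continuousOn hf0
      ((hxq q).mul hf).continuousOn (by simp),
    ← cfcₙ_const_zero ℝ c] at h1
  have h2 := eqOn_of_cfcₙ_eq_cfcₙ h1 hsa (hf.mul ((hxq q).mul hf)).continuousOn (by simp [hf0])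
    continuousOn_const rfl
  refine (q.roots.toFinset.finite_toSet).subset ?_
  rintro x ⟨hx, hxs⟩
  have h3 := h2 hx
  have hfx : f x ≠ 0 := by
    have : f x = x - s ^ 2 := max_eq_left (sub_nonneg.2 (le_of_lt hxs))
    rw [this]; exact sub_ne_zero.2 (ne_of_gt hxs)
  have hx0 : x ≠ 0 := by
    have : s ^ 2 < x := hxs
    have : 0 < s ^ 2 := by positivity
    linarith
  simp only [mul_eq_zero, hfx, hx0, false_or, or_false] at h3
  simp [hq0, h3]

lemma continuousOn_of_vanish (π : 𝒜 →⋆ₙₐ[ℂ] (H →L[ℂ] H)) (hπ : Function.Injective π) (a : 𝒜)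
    (hα : Filter.Tendsto (sSeq (π a)) Filter.atTop (nhds 0)) {s : ℝ} (hs : 0 < s) {g : ℝ → ℝ}
    (hgs : ∀ x ≤ s ^ 2, g x = 0) : ContinuousOn g (quasispectrum ℝ (star a * a)) := by
  intro x hx
  have hs2 : (s / 2) ^ 2 < s ^ 2 := by nlinarith
  rcases lt_or_ge x (s ^ 2) with h | h
  · have : g =ᶠ[nhds x] fun _ => 0 := by
      filter_upwards [gt_mem_nhds h] with y hy using hgs y (le_of_lt hy)
    exact (continuousAt_const.congr this.symm).continuousWithinAt
  · have hfin := finite_spec π hπ a hα (s := s / 2) (by positivity)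
    have hmem : {x} ∈ nhdsWithin x (quasispectrum ℝ (star a * a)) := by
      have h1 : ((quasispectrum ℝ (star a * a) ∩ Set.Ioi ((s / 2) ^ 2)) \ {x})ᶜ ∈ nhds x :=
        (hfin.subset Set.sdiff_subset).isClosed.isOpen_compl.mem_nhds (by simp)
      have h2 : Set.Ioi ((s / 2) ^ 2) ∈ nhds x := lt_mem_nhds (by linarith)
      filter_upwards [self_mem_nhdsWithin, mem_nhdsWithin_of_mem_nhds h1,
        mem_nhdsWithin_of_mem_nhds h2] with y hy1 hy2 hy3
      by_contra hne
      exact hy2 ⟨⟨hy1, hy3⟩, hne⟩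
    have : nhdsWithin x (quasispectrum ℝ (star a * a)) ≤ pure x := by
      rwa [Filter.le_pure_iff]
    exact (tendsto_pure_nhds g x).mono_left this

end blocks

section decomposition

variable {𝒜 : Type*} [NonUnitalCStarAlgebra 𝒜]
variable {H : Type*} [NormedAddCommGroup H] [InnerProductSpace ℂ H] [CompleteSpace H]

/-- Decomposition of `a` into orthogonal dyadic blocks. -/
lemma exists_blocks (π : 𝒜 →⋆ₙₐ[ℂ] (H →L[ℂ] H)) (hπ : Function.Injective π) (a : 𝒜)
    (hα : Filter.Tendsto (sSeq (π a)) Filter.atTop (nhds 0)) {d : ℝ} (hd : 0 < d)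
    (had : ‖a‖ ≤ d) :
    ∃ (A : ℕ → 𝒜) (r : ℕ → ℕ), Monotone r ∧
      (∀ i, LinearMap.rank (π (A i) : H →ₗ[ℂ] H) ≤ ((r (i + 1) - r i : ℕ) : Cardinal)) ∧
      (∀ i n, n < r i → d * (1 / 2) ^ i ≤ sSeq (π a) n) ∧
      (∀ i, ‖A i‖ ≤ d * (1 / 2) ^ i) ∧
      (∀ L, ‖a - ∑ i ∈ Finset.range L, A i‖ ≤ d * (1 / 2) ^ L) ∧
      (∀ i j, i ≠ j → star (A i) * A j = 0 ∧ A i * star (A j) = 0) := by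
  have hsa := IsSelfAdjoint.star_mul_self a
  set c := star a * a with hc
  let s : ℕ → ℝ := fun i => d * (1 / 2) ^ i
  have hs : ∀ i, 0 < s i := fun i => by positivity
  have hsm : ∀ i j, i ≤ j → s j ≤ s i := fun i j hij =>
    mul_le_mul_of_nonneg_left (pow_le_pow_of_le_one (by norm_num) (by norm_num) hij) hd.le
  have hsm2 : ∀ i j, i ≤ j → s j ^ 2 ≤ s i ^ 2 := fun i j hij =>
    pow_le_pow_left₀ (hs j).le (hsm i j hij) 2
  let ind : ℕ → ℝ → ℝ := fun i x => if s i ^ 2 < x then 1 else 0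
  let chi : ℕ → ℝ → ℝ := fun i x => ind (i + 1) x - ind i x
  have hind : ∀ i, ∀ x ≤ s i ^ 2, ind i x = 0 := fun i x hx => if_neg hx.not_gt
  have hchi : ∀ i, ∀ x ≤ s (i + 1) ^ 2, chi i x = 0 := fun i x hx => by
    simp only [chi, hind _ x hx, hind i x (hx.trans (hsm2 i (i + 1) (by omega))), sub_zero]
  have cind : ∀ i, ContinuousOn (ind i) (quasispectrum ℝ c) := fun i =>
    continuousOn_of_vanish π hπ a hα (hs i) (hind i)
  have cchi : ∀ i, ContinuousOn (chi i) (quasispectrum ℝ c) := fun i =>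
    continuousOn_of_vanish π hπ a hα (hs (i + 1)) (hchi i)
  have ind0 : ∀ i, ind i 0 = 0 := fun i => hind i 0 (by positivity)
  have chi0 : ∀ i, chi i 0 = 0 := fun i => hchi i 0 (by positivity)
  let E : ℕ → 𝒜 := fun i => cfcₙ (ind i) c
  let e : ℕ → 𝒜 := fun i => cfcₙ (chi i) c
  have he : ∀ i, e i = E (i + 1) - E i := fun i =>
    cfcₙ_sub (ind (i + 1)) (ind i) c (cind _) (ind0 _) (cind _) (ind0 _)
  -- values of `chi`
  have chi_mul : ∀ i j, i ≠ j → ∀ x, chi i x * chi j x = 0 := by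
    have aux : ∀ i j, i < j → ∀ x, chi i x * chi j x = 0 := by
      intro i j hij x
      have h1 := hsm2 (i + 1) j hij
      by_cases hx : s (i + 1) ^ 2 < x
      · have hj : s j ^ 2 < x := lt_of_le_of_lt h1 hx
        have hj' : s (j + 1) ^ 2 < x := lt_of_le_of_lt (hsm2 j (j + 1) (by omega)) hj
        simp [chi, ind, hj, hj']
      · rw [hchi i x (not_lt.1 hx), zero_mul]
    intro i j hij x
    rcases lt_or_gt_of_ne hij with h | h
    · exact aux i j h x
    · rw [mul_comm]; exact aux j i h x
  have ind_mul : ∀ i x, ind i x * ind i x = ind i x := fun i x => by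
    simp only [ind]; split_ifs <;> simp
  have ind_mul' : ∀ i x, ind (i + 1) x * ind i x = ind i x := fun i x => by
    simp only [ind]
    split_ifs with h1 h2 h2
    · simp
    · simp
    · exact absurd (lt_of_le_of_lt (hsm2 i (i + 1) (by omega)) h2) h1
    · simp
  have EE : ∀ i, E i * E i = E i := fun i => by
    simp only [E]
    rw [← cfcₙ_mul _ _ c (cind i) (ind0 i) (cind i) (ind0 i)]
    simp only [ind_mul]
  have EE' : ∀ i, E (i + 1) * E i = E i := fun i => by
    simp only [E]
    rw [← cfcₙ_mul _ _ c (cind _) (ind0 _) (cind i) (ind0 i)]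
    simp only [ind_mul']
  have Ee : ∀ i, E (i + 1) * e i = e i := fun i => by
    rw [he, mul_sub, EE, EE']
  have Ee0 : ∀ i, E i * e i = 0 := fun i => by
    simp only [E, e]
    rw [← cfcₙ_mul _ _ c (cind i) (ind0 i) (cchi i) (chi0 i), ← cfcₙ_const_zero ℝ c]
    congr 1; funext x
    have h1 := ind_mul i x
    have h2 := ind_mul' i x
    simp only [chi]
    linarith
  -- ranges
  let R : ℕ → Submodule ℂ H := fun i => LinearMap.range (π (E i) : H →ₗ[ℂ] H)
  let Q : ℕ → Submodule ℂ H := fun i => LinearMap.range (π (e i) : H →ₗ[ℂ] H)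
  have fR : ∀ i, FiniteDimensional ℂ (R i) := fun i => by
    obtain ⟨n, hn⟩ := exists_rank_le π a hα (cind i) (hs i) (hind i)
    exact Module.rank_lt_aleph0_iff.1 (lt_of_le_of_lt hn (Cardinal.natCast_lt_aleph0))
  have fQ : ∀ i, FiniteDimensional ℂ (Q i) := fun i => by
    obtain ⟨n, hn⟩ := exists_rank_le π a hα (cchi i) (hs (i + 1)) (hchi i)
    exact Module.rank_lt_aleph0_iff.1 (lt_of_le_of_lt hn (Cardinal.natCast_lt_aleph0))
  have pmul : ∀ x y v, π (x * y) v = π x (π y v) := fun x y v => by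
    rw [map_mul, mul_apply_eq_comp]
  have hadd : ∀ i, Module.finrank ℂ (Q i) + Module.finrank ℂ (R i)
      ≤ Module.finrank ℂ (R (i + 1)) := by
    intro i
    have h1 := Submodule.finrank_sup_add_finrank_inf_eq (Q i) (R i)
    have h2 : Q i ⊔ R i ≤ R (i + 1) := by
      refine sup_le ?_ ?_
      · rintro _ ⟨v, rfl⟩
        exact ⟨π (e i) v, (by
          have := pmul (E (i + 1)) (e i) v
          rw [Ee] at this; exact this.symm)⟩
      · rintro _ ⟨v, rfl⟩
        exact ⟨π (E i) v, (by
          have := pmul (E (i + 1)) (E i) v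
          rw [EE'] at this; exact this.symm)⟩
    have h3 : Q i ⊓ R i = ⊥ := by
      rw [Submodule.eq_bot_iff]
      rintro w ⟨⟨v, hv⟩, ⟨v', hv'⟩⟩
      have hv1 : π (e i) v = w := hv
      have hv2 : π (E i) v' = w := hv'
      have h4 : π (E i) w = 0 := by rw [← hv1, ← pmul, Ee0]; simp
      have h5 : π (E i) w = w := by rw [← hv2, ← pmul, EE]
      rw [← h5, h4]
    rw [h3, finrank_bot, add_zero] at h1
    rw [← h1]
    exact Submodule.finrank_mono h2
  refine ⟨fun i => a * e i, fun i => Module.finrank ℂ (R i), ?_, ?_, ?_, ?_, ?_, ?_⟩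
  · exact monotone_nat_of_le_succ fun i => (Nat.le_add_left _ _).trans (hadd i)
  · intro i
    have h1 : LinearMap.rank (π (a * e i) : H →ₗ[ℂ] H) ≤ LinearMap.rank (π (e i) : H →ₗ[ℂ] H) := by
      have : (π (a * e i) : H →ₗ[ℂ] H) = (π a : H →ₗ[ℂ] H).comp (π (e i) : H →ₗ[ℂ] H) := by
        ext v; exact pmul a (e i) v
      rw [this]
      exact LinearMap.rank_comp_le_right _ _
    refine h1.trans ?_
    have h2 : LinearMap.rank (π (e i) : H →ₗ[ℂ] H) = ((Module.finrank ℂ (Q i) : ℕ) : Cardinal) :=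
      (Module.finrank_eq_rank ℂ (Q i)).symm
    rw [h2]
    have := hadd i
    exact_mod_cast (by omega : Module.finrank ℂ (Q i) ≤
      Module.finrank ℂ (R (i + 1)) - Module.finrank ℂ (R i))
  · intro i n hn
    by_contra hlt
    rw [not_le] at hlt
    have := rank_le_of_bddBelow (π a) (π (E i)) (bddBelow_rep π a (cind i) (hind i)) hlt
    exact hn.not_ge (Module.finrank_le_of_rank_le this)
  · intro i
    refine norm_a_cfcn_le a (cchi i) (chi0 i) (hs i).le ?_
    intro x _ hx0
    by_cases hx : s i ^ 2 < x
    · have : s (i + 1) ^ 2 < x := lt_of_le_of_lt (hsm2 i (i + 1) (by omega)) hx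
      simp only [chi, ind, hx, this, if_true, sub_self, zero_mul]; positivity
    · by_cases hx' : s (i + 1) ^ 2 < x
      · simp only [chi, ind, hx, hx', if_true, if_false]; linarith
      · simp only [chi, ind, hx, hx', if_false, sub_self, zero_mul]; positivity
  · intro L
    have hE0 : E 0 = 0 := by
      simp only [E]
      rw [← cfcₙ_const_zero ℝ c]
      refine cfcₙ_congr fun x hx => hind 0 x ?_
      have h1 := quasi_le a x hx
      have h2 : ‖a‖ ^ 2 ≤ d ^ 2 := pow_le_pow_left₀ (norm_nonneg a) had 2
      simp only [s, pow_zero, mul_one]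
      exact h1.trans h2
    have hsum : ∑ i ∈ Finset.range L, a * e i = a * E L := by
      rw [← Finset.mul_sum]
      congr 1
      simp only [he]
      rw [Finset.sum_range_sub, hE0, sub_zero]
    rw [hsum]
    refine norm_a_sub_cfcn_le a (cind L) (ind0 L) (hs L).le ?_
    intro x _ hx0
    by_cases hx : s L ^ 2 < x
    · simp only [ind, hx, if_true, sub_self, zero_mul]; positivity
    · simp only [ind, hx, if_false]; linarith
  · intro i j hij
    constructor
    · rw [cfcn_mid a (cchi i) (chi0 i) (cchi j) (chi0 j), ← cfcₙ_const_zero ℝ (star a * a)]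
      congr 1; funext x
      linear_combination x * chi_mul i j hij x
    · have : e i * e j = 0 := by
        simp only [e]
        rw [← cfcₙ_mul _ _ c (cchi i) (chi0 i) (cchi j) (chi0 j), ← cfcₙ_const_zero ℝ c]
        congr 1; funext x
        exact chi_mul i j hij x
      rw [star_mul]
      have h2 : star (e j) = e j := star_cfcn _ _
      rw [h2, ← mul_assoc, mul_assoc a, this]
      simp

/-- The norm of a sum of elements with orthogonal domains and ranges. -/
lemma norm_sum_orth {ι : Type*} (s : Finset ι) (y : ι → 𝒜) {M : ℝ} (hM : 0 ≤ M)
    (h : ∀ p ∈ s, ∀ q ∈ s, p ≠ q → star (y p) * y q = 0 ∧ y p * star (y q) = 0)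
    (hy : ∀ p ∈ s, ‖y p‖ ≤ M) : ‖∑ p ∈ s, y p‖ ≤ M := by
  classical
  lift M to NNReal using hM
  let f : ι → 𝒜 := fun p => if p ∈ s then star (y p) * y p else 0
  have h1 : star (∑ p ∈ s, y p) * (∑ p ∈ s, y p) = ∑ p ∈ s, f p := by
    rw [star_sum, Finset.sum_mul_sum]
    refine Finset.sum_congr rfl fun p hp => ?_
    rw [Finset.sum_eq_single_of_mem p hp (fun q hq hqp => (h p hp q hq hqp.symm).1)]
    simp [f, hp]
  have h2 := IsSelfAdjoint.nnnorm_sum_eq_sup (f := f) s (fun p hp => by simp [f, hp])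
    (fun p q hpq => by
      simp only [Function.onFun, f]
      split_ifs with hp hq hq
      · rw [mul_assoc, ← mul_assoc (y p), (h p hp q hq hpq).2]; simp
      all_goals simp)
  refine abs_le_of_sq_le_sq' ?_ M.2 |>.2
  rw [sq, ← CStarRing.norm_star_mul_self, h1]
  have h3 : ‖∑ p ∈ s, f p‖₊ ≤ M ^ 2 := by
    rw [h2]
    refine Finset.sup_le fun p hp => ?_
    rw [← NNReal.coe_le_coe]
    simp only [f, hp, if_true, coe_nnnorm, CStarRing.norm_star_mul_self, NNReal.coe_pow]
    rw [← sq]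
    exact pow_le_pow_left₀ (norm_nonneg _) (hy p hp) 2
  exact_mod_cast h3

lemma Mop_apply (a b x : 𝒜) : Mop a b x = a * (x * b) := rfl

lemma rem_bound {a b : 𝒜} {A B : ℕ → 𝒜} {d : ℝ} (hd : 0 < d) (had : ‖a‖ ≤ d) (hbd : ‖b‖ ≤ d)
    (hA : ∀ i, ‖A i‖ ≤ d * (1 / 2) ^ i) (hB : ∀ i, ‖B i‖ ≤ d * (1 / 2) ^ i)
    (hAL : ∀ L, ‖a - ∑ i ∈ Finset.range L, A i‖ ≤ d * (1 / 2) ^ L)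
    (hBL : ∀ L, ‖b - ∑ i ∈ Finset.range L, B i‖ ≤ d * (1 / 2) ^ L)
    (hAo : ∀ i j, i ≠ j → star (A i) * A j = 0 ∧ A i * star (A j) = 0)
    (hBo : ∀ i j, i ≠ j → star (B i) * B j = 0 ∧ B i * star (B j) = 0) (N : ℕ) :
    ‖Mop a b - ∑ p ∈ (Finset.range N ×ˢ Finset.range N).filter (fun p => p.1 + p.2 < N),
      Mop (A p.1) (B p.2)‖ ≤ 5 * d ^ 2 * (1 / 2) ^ N := by
  refine ContinuousLinearMap.opNorm_le_bound _ (by positivity) fun x => ?_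
  set SA := ∑ i ∈ Finset.range N, A i with hSA
  set SB := ∑ i ∈ Finset.range N, B i with hSB
  let y : ℕ × ℕ → 𝒜 := fun p => A p.1 * (x * B p.2)
  have e1 : SA * (x * SB) = ∑ p ∈ Finset.range N ×ˢ Finset.range N, y p := by
    rw [hSA, hSB, Finset.mul_sum, Finset.sum_mul_sum, Finset.sum_product]
  have e2 := Finset.sum_filter_add_sum_filter_not (Finset.range N ×ˢ Finset.range N)
    (fun p : ℕ × ℕ => p.1 + p.2 < N) y
  set rest := ∑ p ∈ (Finset.range N ×ˢ Finset.range N).filter (fun p => ¬ p.1 + p.2 < N), y p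
    with hrest
  have e3 : rest = ∑ k ∈ Finset.Ico N (2 * N), ∑ p ∈ ((Finset.range N ×ˢ Finset.range N).filter
      (fun p => ¬ p.1 + p.2 < N)).filter (fun p => p.1 + p.2 = k), y p := by
    rw [hrest]
    refine (Finset.sum_fiberwise_of_maps_to (fun p hp => ?_) _).symm
    simp only [Finset.mem_filter, Finset.mem_product, Finset.mem_range] at hp
    rw [Finset.mem_Ico]; omega
  have e4 : ‖rest‖ ≤ 2 * d ^ 2 * (1 / 2) ^ N * ‖x‖ := by
    rw [e3]
    have h1 : ∀ k ∈ Finset.Ico N (2 * N), ‖∑ p ∈ ((Finset.range N ×ˢ Finset.range N).filter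
      (fun p => ¬ p.1 + p.2 < N)).filter (fun p => p.1 + p.2 = k), y p‖
        ≤ (1 / 2) ^ k * (d ^ 2 * ‖x‖) := by
      intro k _
      refine norm_sum_orth _ y (by positivity) ?_ ?_
      · rintro ⟨i, j⟩ hp ⟨i', j'⟩ hq hpq
        simp only [Finset.mem_filter] at hp hq
        have hi : i ≠ i' := by rintro rfl; apply hpq; ext <;> simp; omega
        have hj : j ≠ j' := by rintro rfl; apply hpq; ext <;> simp; omega
        constructor
        · simp only [y, star_mul]
          rw [mul_assoc, ← mul_assoc (star (A i)), (hAo i i' hi).1]; simp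
        · simp only [y, star_mul]
          rw [mul_assoc, mul_assoc x, mul_assoc (star (B j')), ← mul_assoc (B j),
            (hBo j j' hj).2]
          simp
      · rintro ⟨i, j⟩ hp
        simp only [Finset.mem_filter] at hp
        have hk : (1 / 2 : ℝ) ^ k = (1 / 2) ^ i * (1 / 2) ^ j := by rw [← hp.2, pow_add]
        calc ‖A i * (x * B j)‖ ≤ ‖A i‖ * (‖x‖ * ‖B j‖) :=
              (norm_mul_le _ _).trans (mul_le_mul_of_nonneg_left (norm_mul_le _ _) (norm_nonneg _))
          _ ≤ (d * (1 / 2) ^ i) * (‖x‖ * (d * (1 / 2) ^ j)) := by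
              gcongr
              · exact hA i
              · exact hB j
          _ = (1 / 2) ^ k * (d ^ 2 * ‖x‖) := by rw [hk]; ring
    refine (norm_sum_le_of_le _ h1).trans ?_
    rw [← Finset.sum_mul]
    have h2 : ∑ k ∈ Finset.Ico N (2 * N), (1 / 2 : ℝ) ^ k ≤ (1 / 2) ^ N / (1 - 1 / 2) :=
      geom_sum_Ico_le_of_lt_one (by norm_num) (by norm_num)
    calc _ ≤ (1 / 2 : ℝ) ^ N / (1 - 1 / 2) * (d ^ 2 * ‖x‖) :=
          mul_le_mul_of_nonneg_right h2 (by positivity)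
      _ = _ := by ring
  have e5 : (Mop a b - ∑ p ∈ (Finset.range N ×ˢ Finset.range N).filter
      (fun p => p.1 + p.2 < N), Mop (A p.1) (B p.2)) x
      = (a - SA) * (x * b) + SA * (x * (b - SB)) + rest := by
    rw [sub_apply, sum_apply]
    have : ∑ p ∈ (Finset.range N ×ˢ Finset.range N).filter (fun p => p.1 + p.2 < N),
        (Mop (A p.1) (B p.2)) x = SA * (x * SB) - rest := by
      rw [e1, ← e2]; simp only [Mop_apply, y]; abel
    rw [this, Mop_apply]
    simp only [mul_sub, sub_mul]
    abel
  rw [e5]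
  have hSAn : ‖SA‖ ≤ 2 * d := by
    have h1 : ‖SA‖ ≤ ‖a‖ + ‖a - SA‖ := by
      have := norm_sub_le a (a - SA)
      simpa using this
    have h2 : (1 / 2 : ℝ) ^ N ≤ 1 := pow_le_one₀ (by norm_num) (by norm_num)
    have h3 := hAL N
    nlinarith
  have t1 : ‖(a - SA) * (x * b)‖ ≤ (d * (1 / 2) ^ N) * (‖x‖ * d) :=
    (norm_mul_le _ _).trans (mul_le_mul (hAL N) ((norm_mul_le _ _).trans
      (mul_le_mul_of_nonneg_left hbd (norm_nonneg _))) (norm_nonneg _) (by positivity))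
  have t2 : ‖SA * (x * (b - SB))‖ ≤ (2 * d) * (‖x‖ * (d * (1 / 2) ^ N)) :=
    (norm_mul_le _ _).trans (mul_le_mul hSAn ((norm_mul_le _ _).trans
      (mul_le_mul_of_nonneg_left (hBL N) (norm_nonneg _))) (norm_nonneg _) (by positivity))
  calc _ ≤ ‖(a - SA) * (x * b)‖ + ‖SA * (x * (b - SB))‖ + ‖rest‖ := norm_add₃_le
    _ ≤ (d * (1 / 2) ^ N) * (‖x‖ * d) + (2 * d) * (‖x‖ * (d * (1 / 2) ^ N))
        + 2 * d ^ 2 * (1 / 2) ^ N * ‖x‖ := by linarith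
    _ = _ := by ring

/-- The approximation numbers of a two-sided multiplication are dominated by the tensor product
of the sequences of singular numbers. -/
lemma approxNum_Mop_le (π : 𝒜 →⋆ₙₐ[ℂ] (H →L[ℂ] H)) (hπ : Function.Injective π) (a b : 𝒜)
    (ha : toC (sSeq (π a)) ∈ c0) (hb : toC (sSeq (π b)) ∈ c0) (n : ℕ) :
    sSeq (Mop a b) n ≤ 20 * tensorSeq (toC (sSeq (π a))) (toC (sSeq (π b))) n := by
  have tend : ∀ z : 𝒜, toC (sSeq (π z)) ∈ c0 →
      Filter.Tendsto (sSeq (π z)) Filter.atTop (nhds 0) := by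
    intro z hz
    have h1 : Filter.Tendsto (toC (sSeq (π z))) Filter.atTop (nhds 0) := hz
    have h2 := h1.norm
    have h3 : (fun n => ‖toC (sSeq (π z)) n‖) = sSeq (π z) :=
      funext (norm_toC (f := sSeq (π z)) (fun n => approxNum_nonneg _ _))
    rw [h3, norm_zero] at h2
    exact h2
  obtain ⟨d, hd, had, hbd⟩ : ∃ d : ℝ, 0 < d ∧ ‖a‖ ≤ d ∧ ‖b‖ ≤ d :=
    ⟨‖a‖ + ‖b‖ + 1, by positivity, by linarith [norm_nonneg b], by linarith [norm_nonneg a]⟩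
  obtain ⟨A, r, hr, hAr, hrα, hA, hAL, hAo⟩ := exists_blocks π hπ a (tend a ha) hd had
  obtain ⟨B, r', hr', hBr, hrβ, hB, hBL, hBo⟩ := exists_blocks π hπ b (tend b hb) hd hbd
  let P : ℕ → Finset (ℕ × ℕ) := fun N =>
    (Finset.range N ×ˢ Finset.range N).filter (fun p => p.1 + p.2 < N)
  let C : ℕ × ℕ → Finset (ℕ × ℕ) := fun p =>
    Finset.Ico (r p.1) (r (p.1 + 1)) ×ˢ Finset.Ico (r' p.2) (r' (p.2 + 1))
  let G : ℕ → Finset (ℕ × ℕ) := fun N => (P N).biUnion C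
  have uniq : ∀ {q : ℕ → ℕ}, Monotone q → ∀ {i j x : ℕ}, q i ≤ x → x < q (i + 1) → q j ≤ x →
      x < q (j + 1) → i = j := by
    intro q hq i j x h1 h2 h3 h4
    rcases lt_trichotomy i j with h | h | h
    · have := hq (show i + 1 ≤ j from h); omega
    · exact h
    · have := hq (show j + 1 ≤ i from h); omega
  have hGcard : ∀ N, (G N).card = ∑ p ∈ P N, (r (p.1 + 1) - r p.1) * (r' (p.2 + 1) - r' p.2) := by
    intro N
    rw [Finset.card_biUnion]
    · simp [C]
    · rintro ⟨i, j⟩ _ ⟨i', j'⟩ _ hne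
      rw [Function.onFun, Finset.disjoint_left]
      rintro ⟨x, y⟩ h1 h2
      simp only [C, Finset.mem_product, Finset.mem_Ico] at h1 h2
      apply hne
      rw [uniq hr h1.1.1 h1.1.2 h2.1.1 h2.1.2, uniq hr' h1.2.1 h1.2.2 h2.2.1 h2.2.2]
  have hk : ∀ p : ℕ × ℕ, LinearMap.rank (Mop (A p.1) (B p.2) : 𝒜 →ₗ[ℂ] 𝒜) ≤
      (((r (p.1 + 1) - r p.1) * (r' (p.2 + 1) - r' p.2) : ℕ) : Cardinal) := fun p =>
    rank_Mop_le (π : 𝒜 →ₙₐ[ℂ] (H →L[ℂ] H)) hπ _ _ (hAr p.1) (hBr p.2)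
  have hup : ∀ N, (G N).card ≤ n → sSeq (Mop a b) n ≤ 5 * d ^ 2 * (1 / 2) ^ N := by
    intro N hN
    refine le_trans ?_ (rem_bound hd had hbd hA hB hAL hBL hAo hBo N)
    refine approxNum_le ?_
    have e : ((∑ p ∈ P N, Mop (A p.1) (B p.2) : 𝒜 →L[ℂ] 𝒜) : 𝒜 →ₗ[ℂ] 𝒜)
        = ∑ p ∈ P N, (Mop (A p.1) (B p.2) : 𝒜 →ₗ[ℂ] 𝒜) := by
      ext x; simp
    change LinearMap.rank ((∑ p ∈ P N, Mop (A p.1) (B p.2) : 𝒜 →L[ℂ] 𝒜) : 𝒜 →ₗ[ℂ] 𝒜) ≤ _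
    rw [e]
    refine (LinearMap.rank_finsetSum_le _ _).trans ?_
    refine (Finset.sum_le_sum fun p _ => hk p).trans ?_
    rw [← Nat.cast_sum, ← hGcard N]
    exact_mod_cast hN
  have hlow : ∀ N, n < (G N).card → d ^ 2 * (1 / 2) ^ (N + 1) ≤
      tensorSeq (toC (sSeq (π a))) (toC (sSeq (π b))) n := by
    intro N hN
    refine tensorSeq_lower ha hb (G N) hN ?_
    rintro ⟨x, y⟩ hxy
    simp only [G, Finset.mem_biUnion] at hxy
    obtain ⟨⟨i, j⟩, hij, hxy⟩ := hxy
    simp only [P, C, Finset.mem_filter, Finset.mem_product, Finset.mem_Ico] at hij hxy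
    rw [norm_toC (f := sSeq (π a)) (fun n => approxNum_nonneg (π a) (n + 1)),
      norm_toC (f := sSeq (π b)) (fun n => approxNum_nonneg (π b) (n + 1))]
    have h1 := hrα (i + 1) x hxy.1.2
    have h2 := hrβ (j + 1) y hxy.2.2
    have h3 : (1 / 2 : ℝ) ^ (N + 1) ≤ (1 / 2) ^ (i + 1 + (j + 1)) :=
      pow_le_pow_of_le_one (by norm_num) (by norm_num) (by omega)
    calc d ^ 2 * (1 / 2) ^ (N + 1) ≤ d ^ 2 * (1 / 2) ^ (i + 1 + (j + 1)) := by gcongr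
      _ = (d * (1 / 2) ^ (i + 1)) * (d * (1 / 2) ^ (j + 1)) := by rw [pow_add]; ring
      _ ≤ _ := mul_le_mul h1 h2 (by positivity) (approxNum_nonneg _ _)
  by_cases hall : ∀ N, (G N).card ≤ n
  · have h0 : sSeq (Mop a b) n ≤ 0 := by
      have ht : Filter.Tendsto (fun N : ℕ => 5 * d ^ 2 * (1 / 2 : ℝ) ^ N) Filter.atTop
          (nhds (5 * d ^ 2 * 0)) :=
        (tendsto_pow_atTop_nhds_zero_of_lt_one (by norm_num) (by norm_num)).const_mul _
      rw [mul_zero] at ht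
      exact ge_of_tendsto' ht fun N => hup N (hall N)
    have := tensorSeq_nonneg ha hb n
    linarith
  · push Not at hall
    classical
    have hmin := Nat.find_spec hall
    have hpos : Nat.find hall ≠ 0 := by
      intro h
      rw [h] at hmin
      simp [G, P] at hmin
    obtain ⟨N, hN⟩ := Nat.exists_eq_succ_of_ne_zero hpos
    have h1 := hup N (not_lt.1 (Nat.find_min hall (by omega)))
    rw [hN] at hmin
    have h2 := hlow _ hmin
    have h3 : (1 / 2 : ℝ) ^ (N.succ + 1) = (1 / 2) ^ N * (1 / 4) := by
      rw [Nat.succ_eq_add_one, pow_succ, pow_succ]; ring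
    rw [h3] at h2
    linarith

lemma Mop_mem {I : Set (ℕ → ℂ)} (hI : IsStableCalkin I) (π : 𝒜 →⋆ₙₐ[ℂ] (H →L[ℂ] H))
    (hπ : Function.Injective π) (a b : 𝒜) (ha : toC (sSeq (π a)) ∈ I)
    (hb : toC (sSeq (π b)) ∈ I) : toC (sSeq (Mop a b)) ∈ I := by
  obtain ⟨hC, hst⟩ := hI
  have hac := hC.1 ha
  have hbc := hC.1 hb
  have h1 : toC (tensorSeq (toC (sSeq (π a))) (toC (sSeq (π b)))) ∈ I := by
    rw [← hst]
    intro K hK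
    exact hK.2 _ ha _ hb
  have h2 := hC.2.2.2.1 20 _ h1
  refine mem_of_le hC (sSeq_antitone _) (fun n => approxNum_nonneg _ _) h2 (fun n => ?_)
  rw [Pi.smul_apply, norm_smul, norm_toC (tensorSeq_nonneg hac hbc)]
  simpa using approxNum_Mop_le π hπ a b hac hbc n

end decomposition

/-- Let `𝒜` be a C*-algebra, `𝔦` a stable Calkin space,
`a₁,…,aₘ,b₁,…,bₘ ∈ 𝒜` and `Φ = Σᵢ M_{aᵢ,bᵢ}`.  If `π : 𝒜 → B(H)` is a faithful
*-representation such that every `π(aᵢ)`, `π(bᵢ)` is compact with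
`s(π(aᵢ)), s(π(bᵢ)) ∈ 𝔦`, then `(aₙ(Φ))ₙ ∈ 𝔦`. -/
theorem approxNum_elementary_mem {𝒜 : Type u} [NonUnitalNormedRing 𝒜] [StarRing 𝒜]
    [CStarRing 𝒜] [NormedSpace ℂ 𝒜] [IsScalarTower ℂ 𝒜 𝒜] [SMulCommClass ℂ 𝒜 𝒜]
    [StarModule ℂ 𝒜] [CompleteSpace 𝒜]
    {H : Type v} [NormedAddCommGroup H] [InnerProductSpace ℂ H] [CompleteSpace H]
    (I : Set (ℕ → ℂ)) (hI : IsStableCalkin I)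
    (m : ℕ) (a b : Fin m → 𝒜)
    (π : 𝒜 →⋆ₙₐ[ℂ] (H →L[ℂ] H)) (hπ : Function.Injective π)
    (hcomp : ∀ i, IsCompactOperator ⇑(π (a i)) ∧ IsCompactOperator ⇑(π (b i)))
    (hs : ∀ i, toC (sSeq (π (a i))) ∈ I ∧ toC (sSeq (π (b i))) ∈ I) :
    toC (fun n => approxNum (∑ i, Mop (a i) (b i) : 𝒜 →L[ℂ] 𝒜) (n + 1)) ∈ I := by
  letI : NonUnitalCStarAlgebra 𝒜 := { }
  exact sSeq_sum_mem hI.1 Finset.univ (fun i => Mop (a i) (b i))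
    (fun i => Mop_mem hI π hπ (a i) (b i) (hs i).1 (hs i).2)
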